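/- Let E ⊂ ℂ be a compact set with ℋ^1(E) = 0, where ℋ^1 denotes 1-dimensional Hausdorff measure on ℂ. Let f : ℂ → ℂ be continuous on ℂ and holomorphic on ℂ \ E. Then f is holomorphic on all of ℂ. -/

import Mathlib

open MeasureTheory

open Set Metric Complex
open scoped ENNReal Interval

/-- A compact set of vanishing one-dimensional Hausdorff measure has a finite cover by open balls
whose radii have an arbitrarily small sum. -/
theorem exists_finset_cover_ball_sum_lt {X : Type*} [MetricSpace X] [MeasurableSpace X]
    [BorelSpace X] [Nonempty X] {E : Set X} (hE : IsCompact E) (hHE : μH[1] E = 0)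
    {ε : ℝ} (hε : 0 < ε) :
    ∃ (s : Finset ℕ) (c : ℕ → X) (r : ℕ → ℝ), (∀ i, 0 < r i) ∧
      E ⊆ ⋃ i ∈ s, ball (c i) (r i) ∧ ∑ i ∈ s, r i < ε := by
  have hε2 : 0 < ENNReal.ofReal (ε / 2) := ENNReal.ofReal_pos.2 (half_pos hε)
  rw [Measure.hausdorffMeasure_apply] at hHE
  simp only [ENNReal.iSup_eq_zero] at hHE
  have hlt := (hHE 1 one_pos).trans_lt hε2
  simp only [iInf_lt_iff, ENNReal.rpow_one] at hlt
  obtain ⟨t, htE, htd, hts⟩ := hlt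
  obtain ⟨δ, hδ, hδs⟩ := ENNReal.exists_pos_sum_of_countable hε2.ne' ℕ
  have hsum : ∑' n, (ediam (t n) + δ n) < ENNReal.ofReal ε := by
    rw [ENNReal.tsum_add, ← add_halves ε,
      ENNReal.ofReal_add (half_pos hε).le (half_pos hε).le]
    refine ENNReal.add_lt_add (lt_of_eq_of_lt (tsum_congr fun n => ?_) hts) hδs
    rcases (t n).eq_empty_or_nonempty with h | h
    · simp [h]
    · simp [h]
  have hfin : ∀ n, ediam (t n) ≠ ∞ := fun n => ((htd n).trans_lt ENNReal.one_lt_top).ne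
  have hc : ∀ n, ∃ c, t n ⊆ ball c (diam (t n) + δ n) := by
    intro n
    rcases (t n).eq_empty_or_nonempty with h | ⟨c, hc⟩
    · exact ⟨Classical.arbitrary X, by simp [h]⟩
    · refine ⟨c, fun x hx => mem_ball.2 ?_⟩
      have h1 := dist_le_diam_of_mem' (hfin n) hx hc
      have h2 : (0 : ℝ) < δ n := hδ n
      linarith
  choose c hc using hc
  obtain ⟨s, hs⟩ := hE.elim_finite_subcover (fun n => ball (c n) (diam (t n) + δ n))
    (fun n => isOpen_ball) (htE.trans (iUnion_mono hc))
  have hpos : ∀ n, 0 < diam (t n) + δ n := fun n =>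
    add_pos_of_nonneg_of_pos diam_nonneg (hδ n)
  refine ⟨s, c, fun n => diam (t n) + δ n, hpos, hs, ?_⟩
  rw [← ENNReal.ofReal_lt_ofReal_iff hε, ENNReal.ofReal_sum_of_nonneg fun i _ => (hpos i).le]
  refine lt_of_le_of_lt ?_ hsum
  refine (Finset.sum_le_sum fun n _ => ?_).trans (ENNReal.sum_le_tsum s)
  rw [ENNReal.ofReal_add diam_nonneg (δ n).coe_nonneg, diam, ENNReal.ofReal_toReal (hfin n),
    ENNReal.ofReal_coe_nnreal]

/-- The integral of a function dominated by a combination of indicators of balls. -/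
theorem norm_intervalIntegral_le_sum_ball {ι : Type*} (s : Finset ι) {C ρ c : ι → ℝ}
    (hC : ∀ i, 0 ≤ C i) (hρ : ∀ i, 0 ≤ ρ i) {g : ℝ → ℂ} {a b : ℝ}
    (h : ∀ t ∈ Ι a b, ‖g t‖ ≤ ∑ i ∈ s, C i * (ball (c i) (ρ i)).indicator 1 t) :
    ‖∫ t in a..b, g t‖ ≤ ∑ i ∈ s, C i * (2 * ρ i) := by
  have hi : ∀ i, Integrable (fun t : ℝ => C i * (ball (c i) (ρ i)).indicator 1 t) := fun i =>
    ((integrable_indicator_iff measurableSet_ball).2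
      (integrableOn_const measure_ball_lt_top.ne)).const_mul (C i)
  have hI : Integrable fun t : ℝ => ∑ i ∈ s, C i * (ball (c i) (ρ i)).indicator 1 t :=
    integrable_finsetSum _ fun i _ => hi i
  rw [intervalIntegral.norm_intervalIntegral_eq]
  calc ‖∫ t in Ι a b, g t‖
      ≤ ∫ t in Ι a b, ∑ i ∈ s, C i * (ball (c i) (ρ i)).indicator 1 t :=
        norm_integral_le_of_norm_le hI.integrableOn
          ((ae_restrict_iff' measurableSet_uIoc).2 (Filter.Eventually.of_forall h))
    _ ≤ ∫ t, ∑ i ∈ s, C i * (ball (c i) (ρ i)).indicator 1 t :=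
        setIntegral_le_integral hI (Filter.Eventually.of_forall fun t =>
          Finset.sum_nonneg fun i _ => mul_nonneg (hC i)
            (indicator_nonneg (fun _ _ => zero_le_one) t))
    _ = ∑ i ∈ s, C i * (2 * ρ i) := by
        rw [integral_finsetSum _ fun i _ => hi i]
        refine Finset.sum_congr rfl fun i _ => ?_
        rw [integral_const_mul, integral_indicator_one measurableSet_ball, measureReal_def,
          Real.volume_ball, ENNReal.toReal_ofReal (by linarith [hρ i])]

/-- Smooth bump functions adapted to balls, with gradients controlled by the inverse radius. -/
theorem exists_bump_fderiv_le : ∃ M : ℝ, 0 ≤ M ∧ ∀ (c : ℂ) (r : ℝ), 0 < r →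
    ∃ φ : ℂ → ℝ, ContDiff ℝ 1 φ ∧ (∀ z, 0 ≤ φ z) ∧ (∀ z, φ z ≤ 1) ∧
      (∀ z ∈ ball c r, φ z = 1) ∧
      (∀ z, φ z ≤ (ball c (2 * r)).indicator 1 z) ∧
      ∀ z, ‖fderiv ℝ φ z‖ ≤ M / r * (ball c (2 * r)).indicator 1 z := by
  let g : ContDiffBump (0 : ℂ) := ⟨1, 2, one_pos, one_lt_two⟩
  have hg : ContDiff ℝ 1 g := g.contDiff
  obtain ⟨M, hM⟩ := (g.hasCompactSupport.fderiv (𝕜 := ℝ)).exists_bound_of_continuous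
    (hg.continuous_fderiv one_ne_zero)
  refine ⟨M, (norm_nonneg _).trans (hM 0), fun c r hr => ?_⟩
  have hnorm : ∀ z, ‖r⁻¹ • (z - c)‖ = dist z c / r := fun z => by
    rw [norm_smul, norm_inv, Real.norm_of_nonneg hr.le, dist_eq_norm, inv_mul_eq_div]
  have hzero : ∀ z ∉ ball c (2 * r), g (r⁻¹ • (z - c)) = 0 := fun z hz => by
    apply g.zero_of_le_dist
    rw [dist_zero_right, hnorm, le_div_iff₀ hr]
    simpa using hz
  refine ⟨fun z => g (r⁻¹ • (z - c)), hg.comp (by fun_prop), fun z => g.nonneg,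
    fun z => g.le_one, fun z hz => ?_, fun z => ?_, fun z => ?_⟩
  · apply g.one_of_mem_closedBall
    rw [mem_closedBall_zero_iff, hnorm, div_le_iff₀ hr]
    simpa [g] using (mem_ball.1 hz).le
  · by_cases hz : z ∈ ball c (2 * r)
    · rw [indicator_of_mem hz]
      exact g.le_one
    · refine (hzero z hz).trans_le ?_
      exact indicator_nonneg (fun _ _ => zero_le_one) z
  · by_cases hz : z ∈ ball c (2 * r)
    · rw [indicator_of_mem hz, Pi.one_apply, mul_one]
      have hd : HasFDerivAt (fun z => g (r⁻¹ • (z - c)))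
          ((fderiv ℝ g (r⁻¹ • (z - c))).comp (r⁻¹ • ContinuousLinearMap.id ℝ ℂ)) z :=
        ((hg.differentiable one_ne_zero) _).hasFDerivAt.comp z
          (((hasFDerivAt_id z).sub_const c).const_smul r⁻¹)
      rw [hd.fderiv, div_eq_mul_inv]
      refine (ContinuousLinearMap.opNorm_comp_le _ _).trans ?_
      refine mul_le_mul (hM _) ?_ (norm_nonneg _) ((norm_nonneg _).trans (hM 0))
      rw [norm_smul, norm_inv, Real.norm_of_nonneg hr.le]
      exact mul_le_of_le_one_right (inv_nonneg.2 hr.le) ContinuousLinearMap.norm_id_le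
    · have hmin : IsLocalMin (fun z => g (r⁻¹ • (z - c))) z :=
        Filter.Eventually.of_forall fun w => by
          simp only [hzero z hz]
          exact g.nonneg
      rw [hmin.fderiv_eq_zero, indicator_of_notMem hz]
      simp

/-- Smooth functions that vanish on finitely many balls and equal one off the doubled balls, with
gradients controlled by the inverse radii. -/
theorem exists_cutoff_fderiv_le : ∃ M : ℝ, 0 ≤ M ∧ ∀ {ι : Type} (s : Finset ι) (c : ι → ℂ)
    (r : ι → ℝ), (∀ i, 0 < r i) →
    ∃ Φ : ℂ → ℝ, ContDiff ℝ 1 Φ ∧ (∀ z, 0 ≤ Φ z) ∧ (∀ z, Φ z ≤ 1) ∧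
      (∀ i ∈ s, ∀ z ∈ ball (c i) (r i), Φ z = 0) ∧
      (∀ z, 1 - Φ z ≤ ∑ i ∈ s, (ball (c i) (2 * r i)).indicator 1 z) ∧
      ∀ z, ‖fderiv ℝ Φ z‖ ≤ ∑ i ∈ s, M / r i * (ball (c i) (2 * r i)).indicator 1 z := by
  classical
  obtain ⟨M, hM0, hM⟩ := exists_bump_fderiv_le
  refine ⟨M, hM0, fun {ι} s c r hr => ?_⟩
  induction s using Finset.induction_on with
  | empty => exact ⟨fun _ => 1, contDiff_const, by simp, by simp, by simp, by simp, by simp⟩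
  | insert i s his ih =>
    obtain ⟨Φ, hd, h0, h1, hb, hs, hD⟩ := ih
    obtain ⟨φ, hd', h0', h1', hb', hs', hD'⟩ := hM (c i) (r i) (hr i)
    refine ⟨fun z => Φ z * (1 - φ z), hd.mul (contDiff_const.sub hd'),
      fun z => mul_nonneg (h0 z) (sub_nonneg.2 (h1' z)),
      fun z => mul_le_one₀ (h1 z) (sub_nonneg.2 (h1' z)) (by linarith [h0' z]), ?_, ?_, ?_⟩
    · intro j hj z hz
      rcases Finset.mem_insert.1 hj with rfl | hj
      · simp [hb' z hz]
      · simp [hb j hj z hz]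
    · intro z
      rw [Finset.sum_insert his]
      nlinarith [hs z, hs' z, mul_le_mul_of_nonneg_right (h1 z) (h0' z)]
    · intro z
      rw [Finset.sum_insert his]
      have e : HasFDerivAt (fun z => Φ z * (1 - φ z))
          (Φ z • -fderiv ℝ φ z + (1 - φ z) • fderiv ℝ Φ z) z :=
        ((hd.differentiable one_ne_zero) z).hasFDerivAt.mul
        (((hd'.differentiable one_ne_zero) z).hasFDerivAt.const_sub 1)
      rw [e.fderiv]
      refine (norm_add_le _ _).trans (add_le_add ?_ ?_)
      · rw [norm_smul, norm_neg, Real.norm_of_nonneg (h0 z)]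
        exact (mul_le_of_le_one_left (norm_nonneg _) (h1 z)).trans (hD' z)
      · rw [norm_smul, Real.norm_of_nonneg (sub_nonneg.2 (h1' z))]
        exact (mul_le_of_le_one_left (norm_nonneg _) (by linarith [h0' z])).trans (hD z)

/-- The indicator of a disc is bounded by the product of indicators of its projections. -/
theorem indicator_ball_le_re_mul_im (c : ℂ) (ρ : ℝ) (z : ℂ) :
    (ball c ρ).indicator (1 : ℂ → ℝ) z ≤
      (ball c.re ρ).indicator 1 z.re * (ball c.im ρ).indicator 1 z.im := by
  by_cases hz : z ∈ ball c ρ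
  · have hre : z.re ∈ ball c.re ρ := by
      rw [mem_ball, Real.dist_eq, ← sub_re]
      exact (abs_re_le_norm _).trans_lt (by rwa [← dist_eq_norm])
    have him : z.im ∈ ball c.im ρ := by
      rw [mem_ball, Real.dist_eq, ← sub_im]
      exact (abs_im_le_norm _).trans_lt (by rwa [← dist_eq_norm])
    simp [indicator_of_mem hz, indicator_of_mem hre, indicator_of_mem him]
  · rw [indicator_of_notMem hz]
    exact mul_nonneg (indicator_nonneg (fun _ _ => zero_le_one) _)
      (indicator_nonneg (fun _ _ => zero_le_one) _)

theorem indicator_ball_le_re (c : ℂ) (ρ : ℝ) (z : ℂ) :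
    (ball c ρ).indicator (1 : ℂ → ℝ) z ≤ (ball c.re ρ).indicator 1 z.re :=
  (indicator_ball_le_re_mul_im c ρ z).trans <| mul_le_of_le_one_right
    (indicator_nonneg (fun _ _ => zero_le_one) _) (indicator_le_self' (fun _ _ => zero_le_one) _)

theorem indicator_ball_le_im (c : ℂ) (ρ : ℝ) (z : ℂ) :
    (ball c ρ).indicator (1 : ℂ → ℝ) z ≤ (ball c.im ρ).indicator 1 z.im :=
  (indicator_ball_le_re_mul_im c ρ z).trans <| mul_le_of_le_one_left
    (indicator_nonneg (fun _ _ => zero_le_one) _) (indicator_le_self' (fun _ _ => zero_le_one) _)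

theorem wedgeIntegral_add {f g : ℂ → ℂ} (hf : Continuous f) (hg : Continuous g) (z w : ℂ) :
    wedgeIntegral z w (fun x => f x + g x) = wedgeIntegral z w f + wedgeIntegral z w g := by
  unfold wedgeIntegral
  rw [intervalIntegral.integral_add, intervalIntegral.integral_add, smul_add]
  · abel
  all_goals exact Continuous.intervalIntegrable (by fun_prop) _ _

/-- The wedge integral of a function dominated by a combination of indicators of discs. -/
theorem norm_wedgeIntegral_le_sum_ball {ι : Type*} (s : Finset ι) {K : ℝ} (hK : 0 ≤ K)
    {c : ι → ℂ} {ρ : ι → ℝ} (hρ : ∀ i, 0 ≤ ρ i) {g : ℂ → ℂ} {z w : ℂ}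
    (h : ∀ x ∈ [[z.re, w.re]] ×ℂ [[z.im, w.im]],
      ‖g x‖ ≤ ∑ i ∈ s, K * (ball (c i) (ρ i)).indicator 1 x) :
    ‖wedgeIntegral z w g‖ ≤ 2 * ∑ i ∈ s, K * (2 * ρ i) := by
  unfold wedgeIntegral
  rw [two_mul]
  refine (norm_add_le _ _).trans (add_le_add ?_ ?_)
  · refine norm_intervalIntegral_le_sum_ball s (c := fun i => (c i).re) (fun _ => hK) hρ
      fun t ht => ?_
    refine (h _ ?_).trans (Finset.sum_le_sum fun i _ => mul_le_mul_of_nonneg_left ?_ hK)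
    · simpa [mem_reProdIm] using uIoc_subset_uIcc ht
    · simpa using indicator_ball_le_re (c i) (ρ i) (t + z.im * I)
  · rw [norm_smul, norm_I, one_mul]
    refine norm_intervalIntegral_le_sum_ball s (c := fun i => (c i).im) (fun _ => hK) hρ
      fun t ht => ?_
    refine (h _ ?_).trans (Finset.sum_le_sum fun i _ => mul_le_mul_of_nonneg_left ?_ hK)
    · simpa [mem_reProdIm] using uIoc_subset_uIcc ht
    · simpa using indicator_ball_le_im (c i) (ρ i) (w.re + t * I)

/-- An iterated integral of a function dominated by a combination of indicators of discs. -/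
theorem norm_integral_integral_le_sum_ball {ι : Type*} (s : Finset ι) {C ρ : ι → ℝ} {c : ι → ℂ}
    (hC : ∀ i, 0 ≤ C i) (hρ : ∀ i, 0 ≤ ρ i) {g : ℂ → ℂ} {z w : ℂ}
    (h : ∀ x ∈ [[z.re, w.re]] ×ℂ [[z.im, w.im]],
      ‖g x‖ ≤ ∑ i ∈ s, C i * (ball (c i) (ρ i)).indicator 1 x) :
    ‖∫ x in z.re..w.re, ∫ y in z.im..w.im, g (x + y * I)‖ ≤
      ∑ i ∈ s, C i * (2 * ρ i) * (2 * ρ i) := by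
  refine norm_intervalIntegral_le_sum_ball s (c := fun i => (c i).re)
    (fun i => mul_nonneg (hC i) (by linarith [hρ i])) hρ fun x hx => ?_
  have hind : ∀ i, 0 ≤ (ball (c i).re (ρ i)).indicator (1 : ℝ → ℝ) x := fun i =>
    indicator_nonneg (fun _ _ => zero_le_one) _
  refine (norm_intervalIntegral_le_sum_ball s (c := fun i => (c i).im)
    (C := fun i => C i * (ball (c i).re (ρ i)).indicator 1 x)
    (fun i => mul_nonneg (hC i) (hind i)) hρ fun y hy => ?_).trans_eq
    (Finset.sum_congr rfl fun i _ => by ring)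
  refine (h _ ?_).trans (Finset.sum_le_sum fun i _ => ?_)
  · simpa [mem_reProdIm] using And.intro (uIoc_subset_uIcc hx) (uIoc_subset_uIcc hy)
  · rw [mul_assoc]
    refine mul_le_mul_of_nonneg_left ?_ (hC i)
    simpa using indicator_ball_le_re_mul_im (c i) (ρ i) (x + y * I)

/-- Multiplying by a cutoff function vanishing near `E` turns a function holomorphic off `E` into a
differentiable one whose `∂̄`-derivative is controlled by the gradient of the cutoff. -/
theorem differentiable_mul_cutoff {E V : Set ℂ} (hE : IsClosed E) (hV : IsOpen V) (hEV : E ⊆ V)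
    {f : ℂ → ℂ} (hhol : DifferentiableOn ℂ f Eᶜ) {Φ : ℂ → ℝ} (hΦ : Differentiable ℝ Φ)
    (hΦV : ∀ z ∈ V, Φ z = 0) :
    Differentiable ℝ (fun z => f z * Φ z) ∧
      ∀ z, ‖I • fderiv ℝ (fun z => f z * Φ z) z 1 - fderiv ℝ (fun z => f z * Φ z) z I‖ ≤
        2 * ‖f z‖ * ‖fderiv ℝ Φ z‖ := by
  rw [Differentiable, ← forall_and]
  intro z
  by_cases hz : z ∈ E
  · have h0 : HasFDerivAt (fun z => f z * Φ z) (0 : ℂ →L[ℝ] ℂ) z := by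
      refine (hasFDerivAt_const (0 : ℂ) z).congr_of_eventuallyEq ?_
      filter_upwards [hV.mem_nhds (hEV hz)] with x hx
      simp [hΦV x hx]
    refine ⟨h0.differentiableAt, ?_⟩
    rw [h0.fderiv]
    simp only [zero_apply, smul_zero, sub_zero, norm_zero]
    positivity
  · have hf := ((hhol.differentiableAt
      (hE.isOpen_compl.mem_nhds hz)).hasDerivAt.hasFDerivAt).restrictScalars ℝ
    have hΦ' := ofRealCLM.hasFDerivAt.comp z (hΦ z).hasFDerivAt
    have hm : HasFDerivAt (fun z => f z * Φ z) _ z := hf.mul hΦ'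
    refine ⟨hm.differentiableAt, ?_⟩
    rw [hm.fderiv]
    have e1 : ‖fderiv ℝ Φ z 1‖ ≤ ‖fderiv ℝ Φ z‖ := by
      simpa using (fderiv ℝ Φ z).le_opNorm 1
    have e2 : ‖fderiv ℝ Φ z I‖ ≤ ‖fderiv ℝ Φ z‖ := by
      simpa using (fderiv ℝ Φ z).le_opNorm I
    calc _ = ‖f z * (I * (fderiv ℝ Φ z 1 : ℝ) - (fderiv ℝ Φ z I : ℝ))‖ := by
            congr 1
            simp
            ring
      _ ≤ ‖f z‖ * (‖fderiv ℝ Φ z‖ + ‖fderiv ℝ Φ z‖) := by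
            rw [norm_mul]
            refine mul_le_mul_of_nonneg_left ((norm_sub_le _ _).trans ?_) (norm_nonneg _)
            rw [norm_mul, norm_I, one_mul, norm_real, norm_real]
            exact add_le_add e1 e2
      _ = _ := by ring

/-- The integrals over boundaries of rectangles of a continuous function which is holomorphic off a
compact set of vanishing length are zero. -/
theorem isConservativeOn_univ_of_hausdorffMeasure_eq_zero {E : Set ℂ} (hE : IsCompact E)
    (hHE : μH[1] E = 0) {f : ℂ → ℂ} (hf : Continuous f) (hhol : DifferentiableOn ℂ f Eᶜ) :
    IsConservativeOn f univ := by
  intro z w _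
  rw [← add_eq_zero_iff_eq_neg, ← norm_eq_zero]
  obtain ⟨M, hM0, hM⟩ := exists_cutoff_fderiv_le
  have hR : IsCompact ([[z.re, w.re]] ×ℂ [[z.im, w.im]]) := isCompact_uIcc.reProdIm isCompact_uIcc
  obtain ⟨K, hK⟩ := hR.exists_bound_of_continuousOn hf.continuousOn
  have hK0 : 0 ≤ K := (norm_nonneg _).trans (hK z (by simp [mem_reProdIm]))
  refine le_antisymm (le_of_forall_pos_le_add fun δ hδ => ?_) (norm_nonneg _)
  have hA : 0 < 32 * K * M + 16 * K + 1 := by positivity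
  obtain ⟨s, c, r, hr, hEs, hsum⟩ := exists_finset_cover_ball_sum_lt hE hHE (div_pos hδ hA)
  obtain ⟨Φ, hd, h0, h1, hb, hs, hD⟩ := hM s c r hr
  obtain ⟨hPd, hPD⟩ := differentiable_mul_cutoff hE.isClosed
    (isOpen_biUnion fun i _ => isOpen_ball) hEs hhol (hd.differentiable one_ne_zero)
    (fun x hx => by
      obtain ⟨i, hi, hxi⟩ := mem_iUnion₂.1 hx
      exact hb i hi x hxi)
  have hΦc := hd.continuous
  have hρ : ∀ i, 0 ≤ 2 * r i := fun i => by linarith [hr i]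
  have hP : ∀ x ∈ [[z.re, w.re]] ×ℂ [[z.im, w.im]],
      ‖I • fderiv ℝ (fun z => f z * Φ z) x 1 - fderiv ℝ (fun z => f z * Φ z) x I‖ ≤
        2 * K * ‖fderiv ℝ Φ x‖ := fun x hx =>
    (hPD x).trans (by gcongr; exact hK x hx)
  have hint : IntegrableOn (fun x => I • fderiv ℝ (fun z => f z * Φ z) x 1 -
      fderiv ℝ (fun z => f z * Φ z) x I) ([[z.re, w.re]] ×ℂ [[z.im, w.im]]) := by
    refine Integrable.mono' (g := fun x => 2 * K * ‖fderiv ℝ Φ x‖) ?_ ?_ ?_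
    · exact ((hd.continuous_fderiv one_ne_zero).norm.const_mul
        (2 * K)).continuousOn.integrableOn_compact hR
    · exact (((measurable_fderiv_apply_const ℝ _ 1).const_smul I).sub
        (measurable_fderiv_apply_const ℝ _ I)).aestronglyMeasurable
    · exact (ae_restrict_iff' hR.measurableSet).2 (Filter.Eventually.of_forall hP)
  have hbdP : ‖wedgeIntegral z w (fun x => f x * Φ x) + wedgeIntegral w z (fun x => f x * Φ x)‖ ≤
      ∑ i ∈ s, 2 * K * (M / r i) * (2 * (2 * r i)) * (2 * (2 * r i)) := by
    rw [wedgeIntegral_add_wedgeIntegral_eq,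
      integral_boundary_rect_of_differentiableOn_real _ z w hPd.differentiableOn hint]
    refine norm_integral_integral_le_sum_ball s (c := c)
      (g := fun x => I • fderiv ℝ (fun z => f z * Φ z) x 1 - fderiv ℝ (fun z => f z * Φ z) x I)
      (fun i => by have := hr i; positivity) hρ fun x hx => (hP x hx).trans ?_
    refine (mul_le_mul_of_nonneg_left (hD x) (by positivity)).trans_eq ?_
    rw [Finset.mul_sum]
    exact Finset.sum_congr rfl fun i _ => by ring
  have hQ : ∀ x ∈ [[z.re, w.re]] ×ℂ [[z.im, w.im]],
      ‖f x * (1 - Φ x)‖ ≤ ∑ i ∈ s, K * (ball (c i) (2 * r i)).indicator 1 x := fun x hx => by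
    rw [← Finset.mul_sum, norm_mul]
    refine mul_le_mul (hK x hx) ?_ (norm_nonneg _) hK0
    rw [← ofReal_one, ← ofReal_sub, norm_real, Real.norm_of_nonneg (sub_nonneg.2 (h1 x))]
    exact hs x
  have hbdQ := norm_wedgeIntegral_le_sum_ball s hK0 hρ hQ
  have hbdQ' := norm_wedgeIntegral_le_sum_ball (z := w) (w := z) s hK0 hρ
    (by rwa [uIcc_comm w.re, uIcc_comm w.im])
  have hsplit : ∀ a b, wedgeIntegral a b f = wedgeIntegral a b (fun x => f x * Φ x) +
      wedgeIntegral a b (fun x => f x * (1 - Φ x)) := fun a b => by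
    rw [← wedgeIntegral_add (by fun_prop) (by fun_prop)]
    congr 1
    ext x
    ring
  have hS0 : 0 ≤ ∑ i ∈ s, r i := Finset.sum_nonneg fun i _ => (hr i).le
  have hsumP : ∑ i ∈ s, 2 * K * (M / r i) * (2 * (2 * r i)) * (2 * (2 * r i)) =
      32 * K * M * ∑ i ∈ s, r i := by
    rw [Finset.mul_sum]
    refine Finset.sum_congr rfl fun i _ => ?_
    have := (hr i).ne'
    field_simp
    ring
  have hsumQ : ∑ i ∈ s, K * (2 * (2 * r i)) = 4 * K * ∑ i ∈ s, r i := by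
    rw [Finset.mul_sum]
    exact Finset.sum_congr rfl fun i _ => by ring
  rw [hsumP] at hbdP
  rw [hsumQ] at hbdQ hbdQ'
  rw [lt_div_iff₀ hA] at hsum
  rw [hsplit z w, hsplit w z, add_add_add_comm]
  refine (norm_add_le _ _).trans ?_
  have := norm_add_le (wedgeIntegral z w fun x => f x * (1 - Φ x))
    (wedgeIntegral w z fun x => f x * (1 - Φ x))
  linarith

/-- A compact set `E ⊂ ℂ` with `ℋ^1(E) = 0` is removable for continuous
functions holomorphic off `E`. -/
theorem removable_continuous_analytic
    (E : Set ℂ) (hE : IsCompact E)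
    (hHE : μH[1] E = 0)
    (f : ℂ → ℂ) (hf : Continuous f)
    (hhol : DifferentiableOn ℂ f Eᶜ) :
    Differentiable ℂ f :=
  differentiableOn_univ.1 <| IsExactOn.differentiableOn isOpen_univ <|
    (isConservativeOn_univ_of_hausdorffMeasure_eq_zero hE hHE hf hhol).isExactOn_univ hf
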